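/- Let K, E ⊆ ℝⁿ be convex bodies with nonempty interior such that 0 ∈ int E, and let u ∈ co(ℝ≥0) be strictly increasing. Then W_u(K;E) ≤ min{ C(2n,n)·e^{−u(0)}·m_n^u , 4ⁿ·m_n^{2u} } · vol(K)·vol(E) / sup_{y∈ℝⁿ} μ_{u,E}(y − K), where C(2n,n) is the central binomial coefficient, m_i^u = ∫_{u(0)}^{∞} u^{−1}(s)^i e^{−s} ds, and μ_{u,E} is the measure on ℝⁿ with density dμ_{u,E}(x) = e^{−u(|x|_E)} dx. -/

import Mathlib

open scoped Pointwise
open MeasureTheory Metric Real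

/-- The relative distance `d_E(x,K) = min {t ≥ 0 : x ∈ K + tE}`. -/
noncomputable def distE {V : Type*} [AddCommGroup V] [Module ℝ V] (E K : Set V) (x : V) : ℝ :=
  sInf {t : ℝ | 0 ≤ t ∧ x ∈ K + t • E}

/-- The generalized Wills functional `W_u(K;E) = ∫_{ℝⁿ} e^{-u(d_E(x,K))} dx`. -/
noncomputable def willsGen {n : ℕ} (u : ℝ → ℝ) (K E : Set (EuclideanSpace ℝ (Fin n))) : ℝ :=
  ∫ x, Real.exp (-u (distE E K x))

/-- Layer cake formula for exponentials. -/
lemma wlc {X : Type*} [MeasurableSpace X] (ν : Measure X) [SFinite ν] (φ : X → ℝ)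
    (hφ : Measurable φ) (c : ℝ) (hc : ∀ x, c ≤ φ x) :
    ∫⁻ x, ENNReal.ofReal (Real.exp (-φ x)) ∂ν =
      ∫⁻ s in Set.Ici c, ν {x | φ x ≤ s} * ENNReal.ofReal (Real.exp (-s)) := by
  have hms : MeasurableSet {p : X × ℝ | φ p.1 ≤ p.2} :=
    measurableSet_le (hφ.comp measurable_fst) measurable_snd
  have h1 : ∀ x, ENNReal.ofReal (Real.exp (-φ x)) =
      ∫⁻ s in Set.Ici c, Set.indicator {p : X × ℝ | φ p.1 ≤ p.2}
        (fun p => ENNReal.ofReal (Real.exp (-p.2))) (x, s) := by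
    intro x
    have h2 : ∀ s, Set.indicator {p : X × ℝ | φ p.1 ≤ p.2}
        (fun p => ENNReal.ofReal (Real.exp (-p.2))) (x, s) =
        Set.indicator (Set.Ici (φ x)) (fun s => ENNReal.ofReal (Real.exp (-s))) s := by
      intro s
      simp [Set.indicator_apply]
    simp_rw [h2]
    rw [lintegral_indicator measurableSet_Ici, Measure.restrict_restrict measurableSet_Ici,
      Set.inter_eq_left.2 (Set.Ici_subset_Ici.2 (hc x))]
    rw [← ofReal_integral_eq_lintegral_ofReal, integral_Ici_eq_integral_Ioi,
      integral_exp_neg_Ioi]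
    · have := exp_neg_integrableOn_Ioi (φ x) (b := 1) one_pos
      simp only [neg_mul, one_mul] at this
      exact (integrableOn_Ici_iff_integrableOn_Ioi (by simp)).2 this
    · exact Filter.Eventually.of_forall fun s => (Real.exp_pos _).le
  simp_rw [h1]
  rw [lintegral_lintegral_swap]
  · refine lintegral_congr fun s => ?_
    have h3 : ∀ x, Set.indicator {p : X × ℝ | φ p.1 ≤ p.2}
        (fun p => ENNReal.ofReal (Real.exp (-p.2))) (x, s) =
        Set.indicator {x | φ x ≤ s} (fun _ => ENNReal.ofReal (Real.exp (-s))) x := by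
      intro x
      simp [Set.indicator_apply]
    simp_rw [h3]
    rw [lintegral_indicator (measurableSet_le hφ measurable_const), setLIntegral_const, mul_comm]
  · refine Measurable.aemeasurable ?_
    have : Measurable (Set.indicator {p : X × ℝ | φ p.1 ≤ p.2}
        (fun p => ENNReal.ofReal (Real.exp (-p.2)))) :=
      Measurable.indicator (by fun_prop) hms
    exact this

lemma wrearr {a b c d : ENNReal} (hab : a ≤ b) (hcd : c ≤ d) :
    a * d + b * c ≤ a * c + b * d := by
  obtain ⟨p, rfl⟩ := exists_add_of_le hab
  obtain ⟨q, rfl⟩ := exists_add_of_le hcd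
  calc a * (c + q) + (a + p) * c ≤ a * (c + q) + (a + p) * c + p * q := le_self_add
    _ = _ := by ring

/-- The Chebyshev integral inequality. -/
lemma wcheb (ρ : Measure ℝ) [SFinite ρ] (L M : ℝ → ENNReal) (hL : Monotone L) (hM : Monotone M) :
    (∫⁻ s, L s ∂ρ) * (∫⁻ s, M s ∂ρ) ≤ ρ Set.univ * ∫⁻ s, L s * M s ∂ρ := by
  have mL := hL.measurable
  have mM := hM.measurable
  have key : ∀ s t, L s * M t + L t * M s ≤ L s * M s + L t * M t := by
    intro s t
    rcases le_total s t with h | h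
    · exact wrearr (hL h) (hM h)
    · have := wrearr (hL h) (hM h)
      calc _ = L t * M s + L s * M t := add_comm _ _
        _ ≤ _ := this
        _ = _ := add_comm _ _
  have h2 : ∫⁻ s, ∫⁻ t, (L s * M t + L t * M s) ∂ρ ∂ρ ≤
      ∫⁻ s, ∫⁻ t, (L s * M s + L t * M t) ∂ρ ∂ρ :=
    lintegral_mono fun s => lintegral_mono fun t => key s t
  have e1 : ∫⁻ s, ∫⁻ t, (L s * M t + L t * M s) ∂ρ ∂ρ =
      2 * ((∫⁻ s, L s ∂ρ) * (∫⁻ s, M s ∂ρ)) := by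
    have : ∀ s, ∫⁻ t, (L s * M t + L t * M s) ∂ρ =
        L s * (∫⁻ s, M s ∂ρ) + (∫⁻ s, L s ∂ρ) * M s := by
      intro s
      rw [lintegral_add_left (by fun_prop), lintegral_const_mul _ mM, lintegral_mul_const _ mL]
    simp_rw [this]
    rw [lintegral_add_left (by fun_prop), lintegral_const_mul _ mM, lintegral_mul_const _ mL]
    ring
  have e2 : ∫⁻ s, ∫⁻ t, (L s * M s + L t * M t) ∂ρ ∂ρ =
      2 * (ρ Set.univ * ∫⁻ s, L s * M s ∂ρ) := by
    have : ∀ s, ∫⁻ t, (L s * M s + L t * M t) ∂ρ =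
        L s * M s * ρ Set.univ + ∫⁻ s, L s * M s ∂ρ := by
      intro s
      rw [lintegral_add_left (by fun_prop), lintegral_const]
    simp_rw [this]
    rw [lintegral_add_left (by fun_prop), lintegral_mul_const _ (by fun_prop), lintegral_const]
    ring
  rw [e1, e2] at h2
  exact (ENNReal.mul_le_mul_iff_right (by norm_num) (by norm_num)).1 h2

lemma wbeta (n : ℕ) (hn : n ≠ 0) :
    ((2 * n).choose n : ENNReal) * ∫⁻ s in Set.Ioo (0 : ℝ) 1,
      ENNReal.ofReal (n * (1 - s) ^ (n - 1)) * ENNReal.ofReal s ^ n = 1 := by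
  have hn0 : (0 : ℝ) < n := by positivity
  have h := ProbabilityTheory.lintegral_betaPDF_eq_one (α := n + 1) (β := n) (by positivity) hn0
  rw [ProbabilityTheory.lintegral_betaPDF] at h
  rw [← lintegral_const_mul _ (by fun_prop), ← h]
  refine setLIntegral_congr_fun measurableSet_Ioo fun s hs => ?_
  have hs0 := hs.1
  have hs1 : 0 < 1 - s := by linarith [hs.2]
  rw [← ENNReal.ofReal_pow hs0.le, ← ENNReal.ofReal_natCast, ← ENNReal.ofReal_mul (by positivity),
    ← ENNReal.ofReal_mul (by positivity)]
  congr 1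
  have e1 : s ^ ((n : ℝ) + 1 - 1) = s ^ n := by
    rw [add_sub_cancel_right, Real.rpow_natCast]
  have e2 : (1 - s) ^ ((n : ℝ) - 1) = (1 - s) ^ (n - 1) := by
    rw [← Real.rpow_natCast, Nat.cast_sub (by omega)]; simp
  rw [e1, e2]
  have e3 : 1 / ProbabilityTheory.beta (n + 1) n = ((2 * n).choose n : ℝ) * n := by
    rw [ProbabilityTheory.beta, Real.Gamma_nat_eq_factorial]
    obtain ⟨m, rfl⟩ := Nat.exists_eq_succ_of_ne_zero hn
    have : ((m.succ : ℕ) : ℝ) + 1 + (m.succ : ℕ) = ((2 * m.succ : ℕ) : ℝ) + 1 := by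
      push_cast; ring
    rw [this, Real.Gamma_nat_eq_factorial]
    have h4 : Real.Gamma ((m.succ : ℕ) : ℝ) = (m.factorial : ℝ) := by
      rw [← Real.Gamma_nat_eq_factorial]; push_cast; rfl
    rw [h4, Nat.cast_choose ℝ (show m.succ ≤ 2 * m.succ by omega),
      show 2 * m.succ - m.succ = m.succ by omega]
    have h5 : ((m.succ.factorial : ℕ) : ℝ) = (m.succ : ℕ) * (m.factorial : ℝ) := by
      rw [Nat.factorial_succ]; push_cast; rfl
    have h6 : ((m.succ : ℕ) : ℝ) ≠ 0 := by positivity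
    have h7 : (m.factorial : ℝ) ≠ 0 := by positivity
    rw [h5]
    field_simp
  rw [e3]; ring

lemma wker (n : ℕ) (hn : n ≠ 0) (l : ℝ) (hl : l ≤ 1) :
    ∫⁻ s in Set.Icc l 1, ENNReal.ofReal (n * (1 - s) ^ (n - 1)) = ENNReal.ofReal ((1 - l) ^ n) := by
  rw [← ofReal_integral_eq_lintegral_ofReal]
  · congr 1
    rw [integral_Icc_eq_integral_Ioc, ← intervalIntegral.integral_of_le hl,
      intervalIntegral.integral_eq_sub_of_hasDerivAt (f := fun s : ℝ => -(1 - s) ^ n)]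
    · simp [hn]
    · intro x _
      have := (((hasDerivAt_id x).const_sub 1).pow n).neg
      convert this using 1
      · ext; simp
      · simp only [id]; ring
    · exact (by fun_prop : Continuous fun s : ℝ => (n : ℝ) * (1 - s) ^ (n - 1)).intervalIntegrable _ _
  · exact (by fun_prop : Continuous fun s : ℝ => (n : ℝ) * (1 - s) ^ (n - 1)).continuousOn.integrableOn_Icc
  · filter_upwards [ae_restrict_mem measurableSet_Icc] with s hs
    have : 0 ≤ 1 - s := by linarith [hs.2]
    simp only [Pi.zero_apply]
    positivity

/-- The Rogers-Shephard inequality. -/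
lemma wrs {n : ℕ} (A B : Set (EuclideanSpace ℝ (Fin n)))
    (hA : IsCompact A) (hA' : Convex ℝ A) (hB : IsCompact B) (hB' : Convex ℝ B)
    (y : EuclideanSpace ℝ (Fin n)) :
    volume (A + B) * volume (B ∩ (y +ᵥ (-A))) ≤
      ((2 * n).choose n : ENNReal) * (volume A * volume B) := by
  have memI : ∀ z x : EuclideanSpace ℝ (Fin n), x ∈ z +ᵥ (-A) ↔ z - x ∈ A := by
    intro z x
    rw [Set.mem_vadd_set_iff_neg_vadd_mem, Set.mem_neg, vadd_eq_add]
    simp [sub_eq_add_neg, add_comm]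
  rcases Nat.eq_zero_or_pos n with hn0 | hn0
  · subst hn0
    rcases Set.eq_empty_or_nonempty A with rfl | hAn
    · simp
    rcases Set.eq_empty_or_nonempty B with rfl | hBn
    · simp
    rw [hAn.eq_univ, hBn.eq_univ]
    simp
  have hn : n ≠ 0 := hn0.ne'
  set F : EuclideanSpace ℝ (Fin n) → ENNReal := fun z => volume (B ∩ (z +ᵥ (-A))) with hF
  have hFy : F y ≠ ⊤ := ((measure_mono Set.inter_subset_left).trans_lt hB.measure_lt_top).ne
  have hFz : ∀ z, F z ≠ ⊤ := fun z =>
    ((measure_mono Set.inter_subset_left).trans_lt hB.measure_lt_top).ne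
  have mA := hA.isClosed.measurableSet
  have mB := hB.isClosed.measurableSet
  -- total integral
  have mset : MeasurableSet {p : EuclideanSpace ℝ (Fin n) × EuclideanSpace ℝ (Fin n) |
      p.2 ∈ B ∧ p.1 - p.2 ∈ A} :=
    (measurable_snd mB).inter ((measurable_fst.sub measurable_snd) mA)
  have htot : ∫⁻ w, F (y + w) = volume A * volume B := by
    rw [lintegral_add_left_eq_self F y]
    have h1 : ∀ z, F z = ∫⁻ x, Set.indicator {p : EuclideanSpace ℝ (Fin n) × EuclideanSpace ℝ (Fin n) |
      p.2 ∈ B ∧ p.1 - p.2 ∈ A} (fun _ => (1 : ENNReal)) (z, x) := by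
      intro z
      have : F z = ∫⁻ x, Set.indicator {x | x ∈ B ∧ z - x ∈ A} (fun _ => (1 : ENNReal)) x := by
        rw [lintegral_indicator_const, one_mul]
        · simp only [hF]
          congr 1
          ext x
          simp [memI]
        · exact mB.inter ((measurable_const.sub measurable_id) mA)
      rw [this]
      refine lintegral_congr fun x => ?_
      classical simp [Set.indicator_apply]
    rw [lintegral_congr h1, lintegral_lintegral_swap]
    · have h2 : ∀ x, ∫⁻ z, Set.indicator {p : EuclideanSpace ℝ (Fin n) × EuclideanSpace ℝ (Fin n) |
        p.2 ∈ B ∧ p.1 - p.2 ∈ A} (fun _ => (1 : ENNReal)) (z, x) =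
          B.indicator (fun _ => volume A) x := by
        intro x
        by_cases hx : x ∈ B
        · have : ∀ z, Set.indicator {p : EuclideanSpace ℝ (Fin n) × EuclideanSpace ℝ (Fin n) |
            p.2 ∈ B ∧ p.1 - p.2 ∈ A} (fun _ => (1 : ENNReal)) (z, x) =
            A.indicator (fun _ => (1 : ENNReal)) (z - x) := by
            intro z
            classical simp [Set.indicator_apply, hx]
          rw [lintegral_congr this, lintegral_sub_right_eq_self (A.indicator (fun _ => (1 : ENNReal))) x,
            lintegral_indicator_const mA]
          simp [hx]
        · simp [hx]
      rw [lintegral_congr h2, lintegral_indicator_const mB]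
    · exact (measurable_const.indicator mset).aemeasurable
  -- key inclusion
  have key : ∀ z ∈ A + B, ∀ θ : ℝ, 0 ≤ θ → θ ≤ 1 →
      ENNReal.ofReal (θ ^ n) * F y ≤ F (y + (1 - θ) • (z - y)) := by
    rintro z ⟨a, ha, b, hb, rfl⟩ θ h0 h1
    have hsub : ((1 - θ) • b) +ᵥ (θ • (B ∩ (y +ᵥ (-A)))) ⊆
        B ∩ ((y + (1 - θ) • (a + b - y)) +ᵥ (-A)) := by
      rintro _ ⟨_, ⟨x, ⟨hxB, hxA⟩, rfl⟩, rfl⟩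
      rw [memI] at hxA
      refine ⟨?_, ?_⟩
      · exact hB' hb hxB (by linarith) h0 (by ring)
      · rw [memI]
        have := hA' ha hxA (show 0 ≤ 1 - θ by linarith) h0 (by ring)
        convert this using 1
        simp only [vadd_eq_add]
        module
    have := measure_mono (μ := volume) hsub
    rw [measure_vadd, Measure.addHaar_smul_of_nonneg _ h0] at this
    simpa using this
  set C : Set (EuclideanSpace ℝ (Fin n)) := (-y) +ᵥ (A + B) with hC
  have mC : MeasurableSet C := ((hA.add hB).vadd (-y)).isClosed.measurableSet
  have volC : volume C = volume (A + B) := measure_vadd _ _ _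
  set k : ℝ → ENNReal := fun s => ENNReal.ofReal (n * (1 - s) ^ (n - 1)) with hk
  have mk : Measurable k := by fun_prop
  -- pointwise bound
  have pw : ∀ w, ∫⁻ s in Set.Ioo (0 : ℝ) 1,
      C.indicator (fun _ => (1 : ENNReal)) (s⁻¹ • w) * (k s * F y) ≤ F (y + w) := by
    intro w
    set T : Set ℝ := {s | s ∈ Set.Ioo (0 : ℝ) 1 ∧ s⁻¹ • w ∈ C} with hT
    have hTb : ∀ s ∈ T, ENNReal.ofReal ((1 - s) ^ n) * F y ≤ F (y + w) := by
      rintro s ⟨hs, hsw⟩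
      have h1 : y + s⁻¹ • w ∈ A + B := by
        rw [hC, Set.mem_vadd_set_iff_neg_vadd_mem] at hsw
        simpa using hsw
      have := key _ h1 (1 - s) (by linarith [hs.2]) (by linarith [hs.1])
      simpa [smul_smul, hs.1.ne'] using this
    rcases Set.eq_empty_or_nonempty T with hTe | hTn
    · refine le_of_eq_of_le ?_ zero_le
      rw [setLIntegral_congr_fun (g := fun _ => 0) measurableSet_Ioo, lintegral_zero]
      intro s hs
      have : s⁻¹ • w ∉ C := fun h => by
        have : s ∈ T := ⟨hs, h⟩
        simp [hTe] at this
      simp [this]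
    set l := sInf T with hl
    have hbd : BddBelow T := ⟨0, fun s hs => hs.1.1.le⟩
    have hl1 : l ≤ 1 := by
      obtain ⟨s, hs⟩ := hTn
      exact (csInf_le hbd hs).trans hs.1.2.le
    have hlb : ENNReal.ofReal ((1 - l) ^ n) * F y ≤ F (y + w) := by
      have hcl : IsClosed {s : ℝ | ENNReal.ofReal ((1 - s) ^ n) * F y ≤ F (y + w)} := by
        refine isClosed_le ?_ continuous_const
        exact ENNReal.continuous_mul_const hFy |>.comp
          (ENNReal.continuous_ofReal.comp (by fun_prop))
      exact closure_minimal hTb hcl (csInf_mem_closure hTn hbd)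
    refine le_trans ?_ hlb
    rw [← wker n hn l hl1, ← lintegral_mul_const _ mk]
    rw [← lintegral_indicator measurableSet_Ioo, ← lintegral_indicator measurableSet_Icc]
    refine lintegral_mono fun s => ?_
    by_cases hs : s ∈ T
    · have h1 : s ∈ Set.Icc l 1 := ⟨csInf_le hbd hs, hs.1.2.le⟩
      rw [Set.indicator_of_mem hs.1, Set.indicator_of_mem h1, Set.indicator_of_mem hs.2, one_mul]
    · by_cases h2 : s ∈ Set.Ioo (0 : ℝ) 1
      · have h3 : s⁻¹ • w ∉ C := fun h => hs ⟨h2, h⟩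
        simp [h2, h3]
      · simp [h2]
  have hint := lintegral_mono (μ := volume) pw
  rw [htot, lintegral_lintegral_swap] at hint
  · have hin : ∀ s ∈ Set.Ioo (0 : ℝ) 1, ∫⁻ w : EuclideanSpace ℝ (Fin n),
        C.indicator (fun _ => (1 : ENNReal)) (s⁻¹ • w) * (k s * F y) =
        (k s * ENNReal.ofReal s ^ n) * (volume C * F y) := by
      intro s hs
      have h1 : ∀ w : EuclideanSpace ℝ (Fin n), C.indicator (fun _ => (1 : ENNReal)) (s⁻¹ • w) =
          (s • C).indicator (fun _ => (1 : ENNReal)) w := by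
        intro w
        classical simp [Set.indicator_apply, Set.mem_smul_set_iff_inv_smul_mem₀ hs.1.ne']
      rw [lintegral_congr fun w => congrArg (· * (k s * F y)) (h1 w),
        lintegral_mul_const _ (measurable_const.indicator (mC.const_smul₀ s)),
        lintegral_indicator_const (mC.const_smul₀ s), Measure.addHaar_smul_of_nonneg _ hs.1.le]
      simp only [finrank_euclideanSpace, Fintype.card_fin, ENNReal.ofReal_pow hs.1.le]
      ring
    rw [setLIntegral_congr_fun measurableSet_Ioo hin, lintegral_mul_const _ (by fun_prop)] at hint
    calc volume (A + B) * volume (B ∩ (y +ᵥ (-A))) = 1 * (volume C * F y) := by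
          rw [volC, one_mul]
      _ = ((2 * n).choose n : ENNReal) * ((∫⁻ s in Set.Ioo (0 : ℝ) 1,
            k s * ENNReal.ofReal s ^ n) * (volume C * F y)) := by
          rw [← wbeta n hn, mul_assoc]
      _ ≤ _ := by gcongr
  · refine Measurable.aemeasurable ?_
    refine Measurable.mul ?_ (by fun_prop)
    exact (measurable_const.indicator mC).comp
      (f := fun p : EuclideanSpace ℝ (Fin n) × ℝ => p.2⁻¹ • p.1) (by fun_prop)

lemma wgauge {n : ℕ} (E : Set (EuclideanSpace ℝ (Fin n)))
    (hE₁ : IsCompact E) (hE₂ : Convex ℝ E) (hE₃ : (0 : EuclideanSpace ℝ (Fin n)) ∈ interior E)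
    (r : ℝ) (hr : 0 ≤ r) (x : EuclideanSpace ℝ (Fin n)) : gauge E x ≤ r ↔ x ∈ r • E := by
  have hn : E ∈ nhds (0 : EuclideanSpace ℝ (Fin n)) := mem_interior_iff_mem_nhds.1 hE₃
  refine ⟨fun h => ?_, fun h => gauge_le_of_mem hr h⟩
  rcases hr.eq_or_lt with rfl | hr
  · have h0 : gauge E x = 0 := le_antisymm h (gauge_nonneg x)
    rw [gauge_eq_zero (absorbent_nhds_zero hn)
      ((NormedSpace.isVonNBounded_iff ℝ).2 hE₁.isBounded)] at h0
    rw [h0, Set.zero_smul_set ⟨0, mem_of_mem_nhds hn⟩]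
    simp
  · rw [Set.mem_smul_set_iff_inv_smul_mem₀ hr.ne', ← hE₁.isClosed.closure_eq,
      ← gauge_le_one_iff_mem_closure hE₂ hn, gauge_smul_of_nonneg (inv_nonneg.2 hr.le), smul_eq_mul]
    rw [inv_mul_le_iff₀ hr]; simpa using h

lemma wdist {n : ℕ} (K E : Set (EuclideanSpace ℝ (Fin n)))
    (hK₁ : IsCompact K) (hK₃ : K.Nonempty)
    (hE₁ : IsCompact E) (hE₂ : Convex ℝ E) (hE₃ : (0 : EuclideanSpace ℝ (Fin n)) ∈ interior E)
    (x : EuclideanSpace ℝ (Fin n)) :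
    ∃ k ∈ K, distE E K x = gauge E (x - k) ∧ ∀ t, 0 ≤ t → (distE E K x ≤ t ↔ x ∈ K + t • E) := by
  have hn : E ∈ nhds (0 : EuclideanSpace ℝ (Fin n)) := mem_interior_iff_mem_nhds.1 hE₃
  have hc := continuous_gauge hE₂ hn
  have hcc : Continuous fun k => gauge E (x - k) := hc.comp (by fun_prop)
  obtain ⟨k, hk, hmin⟩ := hK₁.exists_isMinOn hK₃ hcc.continuousOn
  have hiff : ∀ t, 0 ≤ t → (x ∈ K + t • E ↔ gauge E (x - k) ≤ t) := by
    intro t ht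
    constructor
    · rintro ⟨a, ha, b, hb, rfl⟩
      have h1 : gauge E (a + b - k) ≤ gauge E (a + b - a) := hmin ha
      refine h1.trans ?_
      rw [add_sub_cancel_left]
      exact gauge_le_of_mem ht hb
    · intro h
      rw [wgauge E hE₁ hE₂ hE₃ t ht] at h
      exact ⟨k, hk, x - k, h, by simp⟩
  have hset : {t : ℝ | 0 ≤ t ∧ x ∈ K + t • E} = Set.Ici (gauge E (x - k)) := by
    ext t
    constructor
    · rintro ⟨h0, h1⟩
      exact (hiff t h0).1 h1
    · intro h
      have h0 : 0 ≤ t := (gauge_nonneg _).trans h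
      exact ⟨h0, (hiff t h0).2 h⟩
  have hd : distE E K x = gauge E (x - k) := by
    rw [distE, hset, csInf_Ici]
  refine ⟨k, hk, hd, fun t ht => ?_⟩
  rw [hd, hiff t ht]

lemma wscale {n : ℕ} (f : EuclideanSpace ℝ (Fin n) → ENNReal) (hf : Measurable f)
    (a : EuclideanSpace ℝ (Fin n)) :
    ∫⁻ x, f ((1 / 2 : ℝ) • (x + a)) = 2 ^ n * ∫⁻ x, f x := by
  rw [lintegral_add_right_eq_self (fun x => f ((1 / 2 : ℝ) • x)) a]
  have h := Measure.map_addHaar_smul (volume : Measure (EuclideanSpace ℝ (Fin n)))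
    (r := 1 / 2) (by norm_num)
  rw [← lintegral_map hf (measurable_const_smul _), h, lintegral_smul_measure]
  simp only [finrank_euclideanSpace, Fintype.card_fin, smul_eq_mul]
  congr 1
  rw [abs_of_pos (by positivity)]
  simp only [one_div, inv_pow, inv_inv]
  rw [ENNReal.ofReal_pow (by norm_num)]
  norm_num

lemma wsecond {n : ℕ} (K E : Set (EuclideanSpace ℝ (Fin n)))
    (hK₁ : IsCompact K) (hK₂ : Convex ℝ K) (hK₃ : K.Nonempty)
    (hE₁ : IsCompact E) (hE₂ : Convex ℝ E) (hE₃ : (0 : EuclideanSpace ℝ (Fin n)) ∈ interior E)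
    (u : ℝ → ℝ) (hu₁ : ConvexOn ℝ (Set.Ici 0) u) (hu₂ : MonotoneOn u (Set.Ici 0))
    (mg : Measurable fun x => u (gauge E x))
    (y : EuclideanSpace ℝ (Fin n)) :
    (∫⁻ z, ENNReal.ofReal (Real.exp (-u (distE E K z)))) *
      (∫⁻ x in y +ᵥ (-K), ENNReal.ofReal (Real.exp (-u (gauge E x)))) ≤
    4 ^ n * (volume K * ∫⁻ x, ENNReal.ofReal (Real.exp (-(2 * u (gauge E x))))) := by
  have hn : E ∈ nhds (0 : EuclideanSpace ℝ (Fin n)) := mem_interior_iff_mem_nhds.1 hE₃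
  have mK := hK₁.isClosed.measurableSet
  have mI : MeasurableSet (y +ᵥ (-K)) := (hK₁.neg.vadd y).isClosed.measurableSet
  have memI : ∀ z x : EuclideanSpace ℝ (Fin n), x ∈ z +ᵥ (-K) ↔ z - x ∈ K := by
    intro z x
    rw [Set.mem_vadd_set_iff_neg_vadd_mem, Set.mem_neg, vadd_eq_add]
    simp [sub_eq_add_neg, add_comm]
  set G : EuclideanSpace ℝ (Fin n) → ENNReal :=
    fun x => ENNReal.ofReal (Real.exp (-(2 * u (gauge E x)))) with hG
  have mG : Measurable G := by
    have : Measurable fun x => Real.exp (-(2 * u (gauge E x))) :=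
      Real.measurable_exp.comp ((mg.const_mul 2).neg)
    exact this.ennreal_ofReal
  have mKi : Measurable (K.indicator (fun _ => (1 : ENNReal))) := measurable_const.indicator mK
  have pw : ∀ z, ENNReal.ofReal (Real.exp (-u (distE E K z))) *
      (∫⁻ x in y +ᵥ (-K), ENNReal.ofReal (Real.exp (-u (gauge E x)))) ≤
      2 ^ n * ∫⁻ q, K.indicator (fun _ => (1 : ENNReal)) ((1 / 2 : ℝ) • (z + (y - (2 : ℝ) • q))) * G q := by
    intro z
    obtain ⟨k, hk, hd, -⟩ := wdist K E hK₁ hK₃ hE₁ hE₂ hE₃ z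
    rw [← wscale _ (by fun_prop) (z - k), ← lintegral_const_mul' _ _
      ENNReal.ofReal_ne_top, ← lintegral_indicator mI]
    refine lintegral_mono fun x => ?_
    by_cases hx : x ∈ y +ᵥ (-K)
    · rw [Set.indicator_of_mem hx]
      rw [memI] at hx
      have h1 : (1 / 2 : ℝ) • (z + (y - (2 : ℝ) • ((1 / 2 : ℝ) • (x + (z - k))))) ∈ K := by
        have := hK₂ hk hx (show (0 : ℝ) ≤ 1 / 2 by norm_num) (show (0 : ℝ) ≤ 1 / 2 by norm_num)
          (by norm_num)
        convert this using 1
        module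
      rw [Set.indicator_of_mem h1, one_mul, ← ENNReal.ofReal_mul (Real.exp_pos _).le, ← Real.exp_add]
      refine ENNReal.ofReal_le_ofReal (Real.exp_le_exp.2 ?_)
      rw [hd]
      have ha := gauge_nonneg (s := E) (z - k)
      have hb := gauge_nonneg (s := E) x
      have h2 : gauge E ((1 / 2 : ℝ) • (x + (z - k))) ≤
          (1 / 2 : ℝ) • gauge E (z - k) + (1 / 2 : ℝ) • gauge E x := by
        rw [gauge_smul_of_nonneg (by norm_num)]
        have := gauge_add_le hE₂ (absorbent_nhds_zero hn) x (z - k)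
        simp only [smul_eq_mul]
        linarith
      have h3 := hu₂ (Set.mem_Ici.2 (gauge_nonneg _)) (Set.mem_Ici.2 ((gauge_nonneg _).trans h2)) h2
      have h4 := hu₁.2 (Set.mem_Ici.2 ha) (Set.mem_Ici.2 hb)
        (show (0 : ℝ) ≤ 1 / 2 by norm_num) (show (0 : ℝ) ≤ 1 / 2 by norm_num) (by norm_num)
      simp only [smul_eq_mul] at h3 h4
      linarith
    · rw [Set.indicator_of_notMem hx]; exact zero_le
  rw [← lintegral_mul_const' _ _ ?_]
  · refine (lintegral_mono pw).trans ?_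
    rw [lintegral_const_mul']
    · rw [lintegral_lintegral_swap]
      · have hin : ∀ q : EuclideanSpace ℝ (Fin n), ∫⁻ z,
            K.indicator (fun _ => (1 : ENNReal)) ((1 / 2 : ℝ) • (z + (y - (2 : ℝ) • q))) * G q =
            (2 ^ n * volume K) * G q := by
          intro q
          rw [lintegral_mul_const _ (by fun_prop), wscale _ mKi, lintegral_indicator_const mK, one_mul]
        rw [lintegral_congr hin, lintegral_const_mul _ mG]
        have : (4 : ENNReal) = 2 * 2 := by norm_num
        rw [this, mul_pow]
        exact le_of_eq (by ring)
      · refine Measurable.aemeasurable ?_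
        refine Measurable.mul ?_ (mG.comp measurable_snd)
        exact mKi.comp (f := fun p : EuclideanSpace ℝ (Fin n) × EuclideanSpace ℝ (Fin n) =>
          (1 / 2 : ℝ) • (p.1 + (y - (2 : ℝ) • p.2))) (by fun_prop)
    · simp
  · refine ne_top_of_le_ne_top (b := ∫⁻ x in y +ᵥ (-K), ENNReal.ofReal (Real.exp (-u 0))) ?_ ?_
    · rw [setLIntegral_const]
      exact ENNReal.mul_ne_top ENNReal.ofReal_ne_top (hK₁.neg.vadd y).measure_lt_top.ne
    · refine lintegral_mono fun x => ENNReal.ofReal_le_ofReal (Real.exp_le_exp.2 ?_)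
      exact neg_le_neg (hu₂ (Set.mem_Ici.2 le_rfl) (Set.mem_Ici.2 (gauge_nonneg _)) (gauge_nonneg _))

lemma wfirst {n : ℕ} (K E : Set (EuclideanSpace ℝ (Fin n)))
    (hK₁ : IsCompact K) (hK₂ : Convex ℝ K) (hK₃ : K.Nonempty)
    (hE₁ : IsCompact E) (hE₂ : Convex ℝ E) (hE₃ : (0 : EuclideanSpace ℝ (Fin n)) ∈ interior E)
    (u : ℝ → ℝ) (hu₂ : StrictMonoOn u (Set.Ici 0))
    (mg : Measurable fun x => u (gauge E x)) (md : Measurable fun x => u (distE E K x))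
    (hd0 : ∀ x, 0 ≤ distE E K x)
    (v : ℝ → ℝ) (hv₂ : ∀ s ∈ Set.Ici (u 0), 0 ≤ v s ∧ u (v s) = s)
    (y : EuclideanSpace ℝ (Fin n)) :
    (∫⁻ z, ENNReal.ofReal (Real.exp (-u (distE E K z)))) *
      (∫⁻ x in y +ᵥ (-K), ENNReal.ofReal (Real.exp (-u (gauge E x)))) ≤
    ENNReal.ofReal (Real.exp (-u 0)) * (((2 * n).choose n : ENNReal) *
      (volume K * ∫⁻ x, ENNReal.ofReal (Real.exp (-u (gauge E x))))) := by
  have mI : MeasurableSet (y +ᵥ (-K)) := (hK₁.neg.vadd y).isClosed.measurableSet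
  have hmono := hu₂.monotoneOn
  have hlow : ∀ t, 0 ≤ t → u 0 ≤ u t := fun t ht =>
    hmono (Set.mem_Ici.2 le_rfl) (Set.mem_Ici.2 ht) ht
  have hinv : ∀ s ∈ Set.Ici (u 0), ∀ t, 0 ≤ t → (u t ≤ s ↔ t ≤ v s) := by
    intro s hs t ht
    obtain ⟨h1, h2⟩ := hv₂ s hs
    conv_lhs => rw [← h2]
    exact hu₂.le_iff_le (Set.mem_Ici.2 ht) (Set.mem_Ici.2 h1)
  set w : ℝ → ENNReal := fun s => ENNReal.ofReal (Real.exp (-s)) with hw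
  have mw : Measurable w := by fun_prop
  set ρ : Measure ℝ := (volume.restrict (Set.Ici (u 0))).withDensity w with hρ
  set L : ℝ → ENNReal := fun s => volume {x | u (distE E K x) ≤ s} with hL
  set M : ℝ → ENNReal := fun s => volume.restrict (y +ᵥ (-K)) {x | u (gauge E x) ≤ s} with hM
  have monoL : Monotone L := fun s t h => measure_mono fun x hx => le_trans hx h
  have monoM : Monotone M := fun s t h => measure_mono fun x hx => le_trans hx h
  have mL := monoL.measurable
  have mM := monoM.measurable
  have hρi : ∀ f : ℝ → ENNReal, Measurable f →
      ∫⁻ s, f s ∂ρ = ∫⁻ s in Set.Ici (u 0), f s * w s := by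
    intro f hf
    rw [hρ, lintegral_withDensity_eq_lintegral_mul _ mw hf]
    refine lintegral_congr fun s => ?_
    simp [mul_comm]
  have hρu : ρ Set.univ = ENNReal.ofReal (Real.exp (-u 0)) := by
    have h := wlc (Measure.dirac ()) (fun _ => u 0) measurable_const (u 0) (fun _ => le_rfl)
    rw [lintegral_dirac] at h
    rw [h, hρ, withDensity_apply _ MeasurableSet.univ, Measure.restrict_univ]
    refine setLIntegral_congr_fun measurableSet_Ici fun s hs => ?_
    have : {x : Unit | u 0 ≤ s} = Set.univ := Set.eq_univ_of_forall fun _ => hs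
    simp [this, hw]
  rw [wlc volume _ md (u 0) (fun x => hlow _ (hd0 x)),
    wlc (volume.restrict (y +ᵥ (-K))) _ mg (u 0) (fun x => hlow _ (gauge_nonneg x)),
    wlc volume _ mg (u 0) (fun x => hlow _ (gauge_nonneg x))]
  have hch := wcheb ρ L M monoL monoM
  rw [hρi L mL, hρi M mM, hρi (fun s => L s * M s) (mL.mul mM), hρu] at hch
  refine hch.trans ?_
  gcongr
  have mN : Measurable fun s => volume {x | u (gauge E x) ≤ s} :=
    Monotone.measurable fun s t h => measure_mono fun x hx => le_trans hx h
  rw [← lintegral_const_mul _ (by fun_prop), ← lintegral_const_mul _ (by fun_prop)]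
  refine setLIntegral_mono' measurableSet_Ici fun s hs => ?_
  obtain ⟨hvs, -⟩ := hv₂ s hs
  have e1 : {x | u (distE E K x) ≤ s} = K + v s • E := by
    ext x
    obtain ⟨-, -, -, h⟩ := wdist K E hK₁ hK₃ hE₁ hE₂ hE₃ x
    rw [← h _ hvs, ← hinv s hs _ (hd0 x)]; rfl
  have e2 : {x | u (gauge E x) ≤ s} = v s • E := by
    ext x
    rw [← wgauge E hE₁ hE₂ hE₃ _ hvs, ← hinv s hs _ (gauge_nonneg x)]; rfl
  have hrs := wrs K (v s • E) hK₁ hK₂ (hE₁.smul (v s)) (hE₂.smul (v s)) y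
  simp only [hL, hM]
  rw [Measure.restrict_apply' mI, e1, e2]
  calc _ ≤ ((2 * n).choose n : ENNReal) * (volume K * volume (v s • E)) * w s := by gcongr
    _ = _ := by ring

lemma wgrow (u : ℝ → ℝ) (hu₁ : ConvexOn ℝ (Set.Ici 0) u) (hu₂ : StrictMonoOn u (Set.Ici 0))
    (v : ℝ → ℝ) (hv₂ : ∀ s ∈ Set.Ici (u 0), 0 ≤ v s ∧ u (v s) = s) (n : ℕ) :
    ∃ D : ℝ, ∀ s ∈ Set.Ici (u 0), v s ^ n ≤ D * Real.exp (s / 2) := by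
  have hc : 0 < u 1 - u 0 := sub_pos.2 (hu₂ (by simp) (by simp) one_pos)
  set c := u 1 - u 0 with hcdef
  have hu : ∀ t, 0 ≤ t → u 0 + c * t - c ≤ u t := by
    intro t ht
    rcases le_total t 1 with h | h
    · have := hu₂.monotoneOn (Set.mem_Ici.2 le_rfl) (Set.mem_Ici.2 ht) ht
      nlinarith
    · have ht0 : 0 < t := by linarith
      have := hu₁.2 (Set.mem_Ici.2 le_rfl) (Set.mem_Ici.2 ht)
        (show (0 : ℝ) ≤ 1 - 1 / t by rw [sub_nonneg, div_le_one ht0]; exact h)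
        (show (0 : ℝ) ≤ 1 / t by positivity) (by ring)
      simp only [smul_eq_mul, mul_zero, zero_add, one_div, inv_mul_cancel₀ ht0.ne'] at this
      have h2 : t * u 1 ≤ (t - 1) * u 0 + u t := by
        calc t * u 1 ≤ t * ((1 - t⁻¹) * u 0 + t⁻¹ * u t) := by gcongr
          _ = _ := by field_simp
      nlinarith
  refine ⟨(2 / c) ^ n * n.factorial * Real.exp ((c - u 0) / 2), fun s hs => ?_⟩
  obtain ⟨h0, h1⟩ := hv₂ s hs
  have h2 := hu _ h0
  rw [h1] at h2
  have h3 : 0 ≤ (s - u 0 + c) / 2 := by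
    have : u 0 ≤ s := hs
    linarith
  have h4 : v s ≤ (2 / c) * ((s - u 0 + c) / 2) := by
    have : (2 / c) * ((s - u 0 + c) / 2) = (s - u 0 + c) / c := by field_simp
    rw [this, le_div_iff₀ hc]
    linarith
  have h5 := Real.pow_div_factorial_le_exp _ h3 n
  rw [div_le_iff₀ (by positivity)] at h5
  calc v s ^ n ≤ ((2 / c) * ((s - u 0 + c) / 2)) ^ n := by gcongr
    _ = (2 / c) ^ n * ((s - u 0 + c) / 2) ^ n := mul_pow _ _ _
    _ ≤ (2 / c) ^ n * (Real.exp ((s - u 0 + c) / 2) * n.factorial) := by gcongr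
    _ = (2 / c) ^ n * n.factorial * Real.exp ((c - u 0) / 2) * Real.exp (s / 2) := by
        rw [mul_assoc _ (Real.exp _) (Real.exp _), ← Real.exp_add]
        rw [show (c - u 0) / 2 + s / 2 = (s - u 0 + c) / 2 by ring]
        ring

lemma wintegrable (v : ℝ → ℝ) (c b D : ℝ) (hb : 0 < b) (n : ℕ) (hm : MonotoneOn v (Set.Ici c))
    (h0 : ∀ s ∈ Set.Ici c, 0 ≤ v s)
    (hD : ∀ s ∈ Set.Ici c, v s ^ n ≤ D * Real.exp ((1 - b) * s)) :
    IntegrableOn (fun s => v s ^ n * Real.exp (-s)) (Set.Ici c) := by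
  have h1 : IntegrableOn (fun s => D * Real.exp (-b * s)) (Set.Ici c) :=
    (((integrableOn_Ici_iff_integrableOn_Ioi (by simp)).2 (exp_neg_integrableOn_Ioi c hb))).const_mul D
  refine Integrable.mono' h1 ?_ ?_
  · exact (((aemeasurable_restrict_of_monotoneOn measurableSet_Ici hm).pow_const n).mul
      (by fun_prop)).aestronglyMeasurable
  · filter_upwards [ae_restrict_mem measurableSet_Ici] with s hs
    rw [Real.norm_of_nonneg (mul_nonneg (pow_nonneg (h0 s hs) n) (Real.exp_pos _).le)]
    calc v s ^ n * Real.exp (-s) ≤ D * Real.exp ((1 - b) * s) * Real.exp (-s) := by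
          gcongr; exact hD s hs
      _ = _ := by rw [mul_assoc, ← Real.exp_add]; ring_nf

/-- Integral of `exp (-φ)` where sublevel sets of `φ` are `v s • E`. -/
lemma wmoment {n : ℕ} (E : Set (EuclideanSpace ℝ (Fin n))) (φ : EuclideanSpace ℝ (Fin n) → ℝ)
    (mφ : Measurable φ) (c : ℝ) (hc : ∀ x, c ≤ φ x) (v : ℝ → ℝ)
    (h0 : ∀ s ∈ Set.Ici c, 0 ≤ v s) (hE : volume E ≠ ⊤)
    (hs : ∀ s ∈ Set.Ici c, {x | φ x ≤ s} = v s • E)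
    (hi : IntegrableOn (fun s => v s ^ n * Real.exp (-s)) (Set.Ici c)) :
    ∫⁻ x, ENNReal.ofReal (Real.exp (-φ x)) =
      ENNReal.ofReal (∫ s in Set.Ici c, v s ^ n * Real.exp (-s)) * volume E := by
  rw [wlc volume φ mφ c hc, ofReal_integral_eq_lintegral_ofReal hi, ← lintegral_mul_const' _ _ hE]
  · refine setLIntegral_congr_fun measurableSet_Ici fun s hs' => ?_
    have hv := h0 s hs'
    simp only [hs s hs']
    rw [Measure.addHaar_smul_of_nonneg _ hv, ENNReal.ofReal_mul (by positivity)]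
    simp only [finrank_euclideanSpace, Fintype.card_fin]
    ring
  · filter_upwards [ae_restrict_mem measurableSet_Ici] with s hs
    exact mul_nonneg (pow_nonneg (h0 s hs) n) (Real.exp_pos _).le

/-- For convex bodies `K, E` with nonempty interior, `0 ∈ int E`, and
`u ∈ co(ℝ≥0)` strictly increasing with inverse `v`:
`W_u(K;E) ≤ min {C(2n,n) e^{-u(0)} m_n^u, 4ⁿ m_n^{2u}} vol(K) vol(E) / sup_y μ_{u,E}(y-K)`,
where `m_i^u = ∫_{u(0)}^∞ u⁻¹(s)^i e^{-s} ds` (so that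
`m_n^{2u} = ∫_{2u(0)}^∞ u⁻¹(s/2)^n e^{-s} ds`) and `dμ_{u,E}(x) = e^{-u(|x|_E)} dx`. -/
theorem willsGen_upper_bound_volume {n : ℕ} (K E : Set (EuclideanSpace ℝ (Fin n)))
    (hK₁ : IsCompact K) (hK₂ : Convex ℝ K) (hK₃ : (interior K).Nonempty)
    (hE₁ : IsCompact E) (hE₂ : Convex ℝ E) (hE₃ : (0 : EuclideanSpace ℝ (Fin n)) ∈ interior E)
    (u : ℝ → ℝ) (hu₁ : ConvexOn ℝ (Set.Ici 0) u) (hu₂ : StrictMonoOn u (Set.Ici 0))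
    (hu₃ : ContinuousOn u (Set.Ici 0))
    (v : ℝ → ℝ) (hv₁ : ∀ t ∈ Set.Ici (0 : ℝ), v (u t) = t)
    (hv₂ : ∀ s ∈ Set.Ici (u 0), 0 ≤ v s ∧ u (v s) = s) :
    willsGen u K E ≤
      min (((2 * n).choose n : ℝ) * Real.exp (-u 0) *
            ∫ s in Set.Ici (u 0), v s ^ n * Real.exp (-s))
          ((4 : ℝ) ^ n * ∫ s in Set.Ici (2 * u 0), v (s / 2) ^ n * Real.exp (-s)) *
        ((volume K).toReal * (volume E).toReal) /
        ⨆ y : EuclideanSpace ℝ (Fin n),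
          ∫ x in y +ᵥ (-K), Real.exp (-u (gauge E x)) := by
  have hKn : K.Nonempty := hK₃.mono interior_subset
  have hn : E ∈ nhds (0 : EuclideanSpace ℝ (Fin n)) := mem_interior_iff_mem_nhds.1 hE₃
  have hmono := hu₂.monotoneOn
  have hlow : ∀ t, 0 ≤ t → u 0 ≤ u t := fun t ht =>
    hmono (Set.mem_Ici.2 le_rfl) (Set.mem_Ici.2 ht) ht
  have hinv : ∀ s ∈ Set.Ici (u 0), ∀ t, 0 ≤ t → (u t ≤ s ↔ t ≤ v s) := by
    intro s hs t ht
    obtain ⟨h1, h2⟩ := hv₂ s hs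
    conv_lhs => rw [← h2]
    exact hu₂.le_iff_le (Set.mem_Ici.2 ht) (Set.mem_Ici.2 h1)
  have hvm : MonotoneOn v (Set.Ici (u 0)) := by
    intro s hs t ht hst
    rw [← hinv t ht _ (hv₂ s hs).1, (hv₂ s hs).2]
    exact hst
  have hd0 : ∀ x, 0 ≤ distE E K x := fun x => Real.sInf_nonneg fun t ht => ht.1
  have hcu : Continuous fun t => u (max t 0) :=
    hu₃.comp_continuous (by fun_prop) fun t => Set.mem_Ici.2 (le_max_right _ _)
  have cg : Continuous fun x => u (gauge E x) := by
    have := hcu.comp (continuous_gauge hE₂ hn)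
    refine this.congr fun x => ?_
    simp [max_eq_left (gauge_nonneg x)]
  have mg := cg.measurable
  have mdist : Measurable (distE E K) := by
    refine measurable_of_Iic fun t => ?_
    rcases lt_or_ge t 0 with ht | ht
    · convert MeasurableSet.empty
      ext x
      simp only [Set.mem_preimage, Set.mem_Iic, Set.mem_empty_iff_false, iff_false, not_le]
      exact ht.trans_le (hd0 x)
    · have : distE E K ⁻¹' Set.Iic t = K + t • E := by
        ext x
        obtain ⟨-, -, -, h⟩ := wdist K E hK₁ hKn hE₁ hE₂ hE₃ x
        exact h t ht
      rw [this]
      exact (hK₁.add (hE₁.smul t)).isClosed.measurableSet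
  have md : Measurable fun x => u (distE E K x) := by
    have := hcu.measurable.comp mdist
    convert this using 2 with x
    simp [max_eq_left (hd0 x)]
  have hEt : volume E ≠ ⊤ := hE₁.measure_lt_top.ne
  have hKt : volume K ≠ ⊤ := hK₁.measure_lt_top.ne
  obtain ⟨D, hD⟩ := wgrow u hu₁ hu₂ v hv₂ n
  have hhalf : ∀ s ∈ Set.Ici (2 * u 0), s / 2 ∈ Set.Ici (u 0) := by
    intro s hs
    have : 2 * u 0 ≤ s := hs
    simp only [Set.mem_Ici]; linarith
  have hi1 : IntegrableOn (fun s => v s ^ n * Real.exp (-s)) (Set.Ici (u 0)) := by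
    refine wintegrable v (u 0) (1 / 2) D (by norm_num) n hvm (fun s hs => (hv₂ s hs).1) ?_
    intro s hs
    convert hD s hs using 3
    ring
  have hi2 : IntegrableOn (fun s => v (s / 2) ^ n * Real.exp (-s)) (Set.Ici (2 * u 0)) := by
    refine wintegrable (fun s => v (s / 2)) (2 * u 0) (3 / 4) D (by norm_num) n ?_
      (fun s hs => (hv₂ _ (hhalf s hs)).1) ?_
    · intro s hs t ht hst
      exact hvm (hhalf s hs) (hhalf t ht) (by linarith)
    · intro s hs
      convert hD _ (hhalf s hs) using 3
      ring
  have hm1 := wmoment E _ mg (u 0) (fun x => hlow _ (gauge_nonneg x)) v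
    (fun s hs => (hv₂ s hs).1) hEt (by
      intro s hs
      ext x
      rw [← wgauge E hE₁ hE₂ hE₃ _ (hv₂ s hs).1, ← hinv s hs _ (gauge_nonneg x)]; rfl) hi1
  have hm2 := wmoment E (fun x => 2 * u (gauge E x)) (mg.const_mul 2) (2 * u 0)
    (fun x => by linarith [hlow _ (gauge_nonneg (s := E) x)]) (fun s => v (s / 2))
    (fun s hs => (hv₂ _ (hhalf s hs)).1) hEt (by
      intro s hs
      ext x
      rw [← wgauge E hE₁ hE₂ hE₃ _ (hv₂ _ (hhalf s hs)).1,
        ← hinv _ (hhalf s hs) _ (gauge_nonneg x)]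
      simp only [Set.mem_ofPred_eq]
      constructor <;> intro h <;> linarith) hi2
  have hM1 : 0 ≤ ∫ s in Set.Ici (u 0), v s ^ n * Real.exp (-s) :=
    setIntegral_nonneg measurableSet_Ici fun s hs =>
      mul_nonneg (pow_nonneg (hv₂ s hs).1 n) (Real.exp_pos _).le
  have hM2 : 0 ≤ ∫ s in Set.Ici (2 * u 0), v (s / 2) ^ n * Real.exp (-s) :=
    setIntegral_nonneg measurableSet_Ici fun s hs =>
      mul_nonneg (pow_nonneg (hv₂ _ (hhalf s hs)).1 n) (Real.exp_pos _).le
  set M1 := ∫ s in Set.Ici (u 0), v s ^ n * Real.exp (-s) with hM1d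
  set M2 := ∫ s in Set.Ici (2 * u 0), v (s / 2) ^ n * Real.exp (-s) with hM2d
  have hW : willsGen u K E = (∫⁻ z, ENNReal.ofReal (Real.exp (-u (distE E K z)))).toReal := by
    rw [willsGen, integral_eq_lintegral_of_nonneg_ae
      (Filter.Eventually.of_forall fun x => (Real.exp_pos _).le)]
    exact (Real.measurable_exp.comp md.neg).aestronglyMeasurable
  have hW0 : 0 ≤ willsGen u K E := by rw [hW]; exact ENNReal.toReal_nonneg
  set I : EuclideanSpace ℝ (Fin n) → ℝ :=
    fun y => ∫ x in y +ᵥ (-K), Real.exp (-u (gauge E x)) with hI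
  have cexp : Continuous fun x => Real.exp (-u (gauge E x)) := Real.continuous_exp.comp cg.neg
  have hIy : ∀ y, I y = (∫⁻ x in y +ᵥ (-K), ENNReal.ofReal (Real.exp (-u (gauge E x)))).toReal := by
    intro y
    simp only [hI]
    rw [integral_eq_lintegral_of_nonneg_ae
      (Filter.Eventually.of_forall fun x => (Real.exp_pos _).le)]
    exact cexp.aestronglyMeasurable
  have cI : ∀ y : EuclideanSpace ℝ (Fin n), IsCompact (y +ᵥ (-K)) := fun y => hK₁.neg.vadd y
  have vI : ∀ y : EuclideanSpace ℝ (Fin n), volume (y +ᵥ (-K)) = volume K := by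
    intro y
    rw [measure_vadd, Measure.measure_neg]
  have hint : ∀ y, IntegrableOn (fun x => Real.exp (-u (gauge E x))) (y +ᵥ (-K)) := fun y =>
    cexp.continuousOn.integrableOn_compact (cI y)
  have hbdd : BddAbove (Set.range I) := by
    refine ⟨Real.exp (-u 0) * (volume K).toReal, ?_⟩
    rintro _ ⟨y, rfl⟩
    calc I y ≤ ∫ x in y +ᵥ (-K), Real.exp (-u 0) := by
          refine setIntegral_mono (hint y) (integrableOn_const (by rw [vI]; exact hKt)) ?_
          intro x
          exact Real.exp_le_exp.2 (neg_le_neg (hlow _ (gauge_nonneg x)))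
      _ = _ := by
          rw [setIntegral_const, Measure.real, vI, smul_eq_mul, mul_comm]
  have hKpos : volume K ≠ 0 :=
    ((isOpen_interior.measure_pos volume hK₃).trans_le (measure_mono interior_subset)).ne'
  have hIpos : 0 < I 0 := by
    have : NeZero (volume.restrict ((0 : EuclideanSpace ℝ (Fin n)) +ᵥ (-K))) :=
      ⟨by rw [Ne, Measure.restrict_eq_zero, vI]; exact hKpos⟩
    exact integral_exp_pos (hint 0)
  have hsup : 0 < ⨆ y, I y := hIpos.trans_le (le_ciSup hbdd 0)
  rw [le_div_iff₀ hsup, Real.mul_iSup_of_nonneg hW0]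
  refine ciSup_le fun y => ?_
  rw [min_mul_of_nonneg _ _ (by positivity)]
  have hprod : willsGen u K E * I y = ((∫⁻ z, ENNReal.ofReal (Real.exp (-u (distE E K z)))) *
      (∫⁻ x in y +ᵥ (-K), ENNReal.ofReal (Real.exp (-u (gauge E x))))).toReal := by
    rw [hW, hIy, ENNReal.toReal_mul]
  refine le_min ?_ ?_
  · have h := wfirst K E hK₁ hK₂ hKn hE₁ hE₂ hE₃ u hu₂ mg md hd0 v hv₂ y
    rw [hm1] at h
    rw [hprod]
    refine (ENNReal.toReal_mono (by finiteness) h).trans (le_of_eq ?_)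
    simp only [ENNReal.toReal_mul, ENNReal.toReal_ofReal (Real.exp_pos _).le,
      ENNReal.toReal_ofReal hM1, ENNReal.toReal_natCast]
    ring
  · have h := wsecond K E hK₁ hK₂ hKn hE₁ hE₂ hE₃ u hu₁ hmono mg y
    rw [hm2] at h
    rw [hprod]
    refine (ENNReal.toReal_mono (by finiteness) h).trans (le_of_eq ?_)
    simp only [ENNReal.toReal_mul, ENNReal.toReal_ofReal hM2, ENNReal.toReal_pow,
      ENNReal.toReal_ofNat]
    ring
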